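/- arXiv:1409.5113 — 2 statements merged into one kernel-verified Lean document; each statement's English description precedes it below -/
import Mathlib

section
/- Let X be a spectral space and let Y be a subset of X. The following are equivalent: (1) Y is quasicompact (in the subspace topology); (2) inv(Y) = gen(Y); (3) pt(Y) ⊆ Y. -/
open TopologicalSpace Set

/-- A topological space is *spectral* if it is quasicompact, `T0`, quasi-sober (every nonempty
irreducible closed subset has a generic point), its quasicompact open subsets are closed under
finite intersections (quasi-separatedness) and form a basis for the topology. -/
def IsSpectralTop (X : Type*) [TopologicalSpace X] : Prop :=
  CompactSpace X ∧ T0Space X ∧ QuasiSober X ∧ QuasiSeparatedSpace X ∧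
    IsTopologicalBasis {U : Set X | IsOpen U ∧ IsCompact U}

variable {X : Type*} [TopologicalSpace X]

/-- `invC Y` : the intersection of all quasicompact open subsets of `X` containing `Y`. -/
def invC (Y : Set X) : Set X := ⋂₀ {U : Set X | (IsOpen U ∧ IsCompact U) ∧ Y ⊆ U}

/-- `genC Y` : the set of all generalizations of points of `Y`,
i.e. `{x : cl({x}) ∩ Y ≠ ∅}`. -/
def genC (Y : Set X) : Set X := {x : X | (closure {x} ∩ Y).Nonempty}

/-- `patchC Y` : the intersection of all subsets of the form `U₁ ∪ U₂ᶜ` containing `Y`, where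
`U₁`, `U₂` are quasicompact open subsets of `X`. -/
def patchC (Y : Set X) : Set X :=
  ⋂₀ {S : Set X | (∃ U₁ U₂ : Set X, (IsOpen U₁ ∧ IsCompact U₁) ∧ (IsOpen U₂ ∧ IsCompact U₂) ∧
      S = U₁ ∪ U₂ᶜ) ∧ Y ⊆ S}

/-- `ptC Y` : the set of points of `invC Y` that are closed in the subspace topology
of `invC Y`. -/
def ptC (Y : Set X) : Set X :=
  {x : X | ∃ h : x ∈ invC Y, IsClosed ({⟨x, h⟩} : Set ↥(invC Y))}

theorem mem_genC_iff {Y : Set X} {x : X} : x ∈ genC Y ↔ ∃ y ∈ Y, x ⤳ y := by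
  simp only [genC, Set.mem_ofPred_eq, Set.Nonempty, mem_inter_iff, specializes_iff_mem_closure,
    and_comm]

theorem subset_genC (Y : Set X) : Y ⊆ genC Y := fun x hx ↦
  mem_genC_iff.2 ⟨x, hx, specializes_rfl⟩

theorem subset_invC (Y : Set X) : Y ⊆ invC Y := subset_sInter fun _ hU ↦ hU.2

theorem IsOpen.genC_subset {Y U : Set X} (hU : IsOpen U) (hYU : Y ⊆ U) : genC Y ⊆ U := by
  intro x hx
  obtain ⟨y, hy, hxy⟩ := mem_genC_iff.1 hx
  exact hxy.mem_open hU (hYU hy)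

theorem genC_subset_invC (Y : Set X) : genC Y ⊆ invC Y :=
  subset_sInter fun _ hU ↦ hU.1.1.genC_subset hU.2

theorem isCompact_invC [CompactSpace X] [QuasiSober X] [QuasiSeparatedSpace X]
    [PrespectralSpace X] (Y : Set X) : IsCompact (invC Y) := by
  let e : WithConstructibleTopology X → X := WithTopology.ofTopology
  have hopen {U : Set X} (hU : IsOpen U) (hc : IsCompact U) : IsOpen (e ⁻¹' U) :=
    WithConstructibleTopology.isOpen_iff.2 (hc.isOpen_constructibleTopology_of_isOpen hU)
  have hclosed {U : Set X} (hU : IsOpen U) (hc : IsCompact U) : IsClosed (e ⁻¹' U) := by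
    rw [← isOpen_compl_iff, ← preimage_compl]
    exact WithConstructibleTopology.isOpen_iff.2
      (IsCompact.isOpen_constructibleTopology_of_isClosed (s := Uᶜ) (by rwa [compl_compl])
        hU.isClosed_compl)
  have he : Continuous e :=
    PrespectralSpace.isTopologicalBasis.continuous_iff.2 fun U hU ↦ hopen hU.1 hU.2
  have hinv : IsClosed (e ⁻¹' invC Y) := by
    rw [invC, preimage_sInter]
    exact isClosed_biInter fun U hU ↦ hclosed hU.1.1 hU.1.2
  have hsurj : Function.Surjective e := fun x ↦ ⟨WithTopology.toTopology _ x, rfl⟩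
  rw [← image_preimage_eq (invC Y) hsurj]
  exact hinv.isCompact.image he

theorem IsCompact.invC_subset_genC [PrespectralSpace X] {Y : Set X} (hY : IsCompact Y) :
    invC Y ⊆ genC Y := by
  intro x hx
  by_contra hgen
  have hsub : Y ⊆ (closure {x})ᶜ := fun y hy hyx ↦ hgen ⟨y, hyx, hy⟩
  obtain ⟨U, hUc, hUo, hYU, hU⟩ :=
    PrespectralSpace.exists_isCompact_and_isOpen_between hY isClosed_closure.isOpen_compl hsub
  exact hU (hx U ⟨⟨hUo, hUc⟩, hYU⟩) (subset_closure rfl)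

theorem isCompact_of_isCompact_genC {Y : Set X} (h : IsCompact (genC Y)) : IsCompact Y := by
  refine isCompact_of_finite_subcover fun U hU hYU ↦ ?_
  obtain ⟨t, ht⟩ := h.elim_finite_subcover U hU ((isOpen_iUnion hU).genC_subset hYU)
  exact ⟨t, (subset_genC Y).trans ht⟩

theorem eq_of_mem_ptC_of_specializes {Y : Set X} {x y : X} (hx : x ∈ ptC Y) (hy : y ∈ invC Y)
    (h : x ⤳ y) : y = x := by
  obtain ⟨hx, hcl⟩ := hx
  have hxy : (⟨x, hx⟩ : invC Y) ⤳ ⟨y, hy⟩ := (subtype_specializes_iff _ _).2 h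
  exact congrArg Subtype.val (hxy.mem_closed hcl rfl : (⟨y, hy⟩ : invC Y) = ⟨x, hx⟩)

theorem exists_specializes_mem_ptC [T0Space X] {Y : Set X} (hc : IsCompact (invC Y)) {x : X}
    (hx : x ∈ invC Y) : ∃ y ∈ ptC Y, x ⤳ y := by
  have := isCompact_iff_compactSpace.1 hc
  obtain ⟨y, hy, hcl⟩ := (isClosed_closure (s := {(⟨x, hx⟩ : invC Y)})).exists_closed_singleton
    ⟨_, subset_closure rfl⟩
  exact ⟨y, ⟨y.2, hcl⟩, (subtype_specializes_iff _ _).1 (specializes_iff_mem_closure.2 hy)⟩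

/-- For a subset `Y` of a spectral space `X`, the following are equivalent:
(1) `Y` is quasicompact; (2) `inv(Y) = gen(Y)`; (3) `pt(Y) ⊆ Y`. -/
theorem stmt3 (hX : IsSpectralTop X) (Y : Set X) :
    (IsCompact Y ↔ invC Y = genC Y) ∧ (invC Y = genC Y ↔ ptC Y ⊆ Y) := by
  obtain ⟨_, _, _, _, hB⟩ := hX
  have : PrespectralSpace X := ⟨hB⟩
  have hc := isCompact_invC Y
  refine ⟨⟨fun hY ↦ hY.invC_subset_genC.antisymm (genC_subset_invC Y),
    fun h ↦ isCompact_of_isCompact_genC (h ▸ hc)⟩, fun h x hx ↦ ?_, fun h ↦ ?_⟩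
  · obtain ⟨y, hy, hxy⟩ := mem_genC_iff.1 (h ▸ hx.1)
    exact eq_of_mem_ptC_of_specializes hx (subset_invC Y hy) hxy ▸ hy
  · refine Subset.antisymm (fun x hx ↦ ?_) (genC_subset_invC Y)
    obtain ⟨y, hy, hxy⟩ := exists_specializes_mem_ptC hc hx
    exact mem_genC_iff.2 ⟨y, h hy, hxy⟩
end

section
/- Let Y be the projective limit of a cofiltered projective system {X_i ; f_{ij}} of spectral spaces with spectral transition maps, with projections d_i : Y → X_i, and let Z be a subset of Y. Then the families {patch(d_i(Z))} and {inv(d_i(Z))} form projective systems under the (restricted) transition maps, and the projections induce homeomorphisms patch(Z) ≅ lim patch(d_i(Z)) and inv(Z) ≅ lim inv(d_i(Z)), where patch and inv on the left are taken in Y and on the right in the respective X_i. -/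
open TopologicalSpace Set

variable {X : Type*} [TopologicalSpace X]

/-- The projective (inverse) limit of a projective system `{X i ; f h}` indexed by a preorder,
realized as the subspace of compatible tuples in the product. -/
def InvLim {ι : Type*} [Preorder ι] {X : ι → Type*} (f : ∀ ⦃i j : ι⦄, i ≤ j → X j → X i) :
    Set (∀ i, X i) :=
  {y | ∀ ⦃i j : ι⦄ (h : i ≤ j), f h (y j) = y i}

/-- The canonical projection from the projective limit to the `i`-th space. -/
def proj {ι : Type*} [Preorder ι] {X : ι → Type*} (f : ∀ ⦃i j : ι⦄, i ≤ j → X j → X i) (i : ι) :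
    ↥(InvLim f) → X i :=
  fun y => (y : ∀ i, X i) i

lemma IsSpectralTop.isTopologicalBasis (hX : IsSpectralTop X) :
    IsTopologicalBasis {U : Set X | IsOpen U ∧ IsCompact U} :=
  hX.2.2.2.2

lemma IsSpectralTop.compactSpace_constructible (hX : IsSpectralTop X) :
    CompactSpace (WithConstructibleTopology X) := by
  obtain ⟨_, _, _, _, hB⟩ := hX
  have : PrespectralSpace X := ⟨hB⟩
  infer_instance

lemma IsCompact.isClopen_constructible_preimage {U : Set X} (hU : IsCompact U) (ho : IsOpen U) :
    IsClopen (WithTopology.ofTopology (t := constructibleTopology X) ⁻¹' U) := by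
  constructor
  · rw [← isOpen_compl_iff]
    exact IsCompact.isOpen_constructibleTopology_of_isClosed (s := Uᶜ) (by rwa [compl_compl])
      ho.isClosed_compl
  · exact hU.isOpen_constructibleTopology_of_isOpen ho

lemma IsSpectralTop.continuous_ofTopology (hX : IsSpectralTop X) :
    Continuous (WithTopology.ofTopology (t := constructibleTopology X)) :=
  hX.isTopologicalBasis.continuous_iff.2 fun _ hU =>
    (hU.2.isClopen_constructible_preimage hU.1).isOpen

lemma IsSpectralTop.eq_of_forall_mem_iff (hX : IsSpectralTop X) {x y : X}
    (h : ∀ U : Set X, IsOpen U → IsCompact U → (x ∈ U ↔ y ∈ U)) : x = y := by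
  have := hX.2.1
  refine Inseparable.eq (hX.isTopologicalBasis.inseparable_iff.2 fun U hU => h U hU.1 hU.2)

section InvLim

variable {ι : Type*} [Preorder ι] {X : ι → Type*}
  {f : ∀ ⦃i j : ι⦄, i ≤ j → X j → X i}

lemma image_proj_image {i j : ι} (h : i ≤ j) (Z : Set ↥(InvLim f)) :
    f h '' (proj f j '' Z) = proj f i '' Z := by
  rw [image_image]
  exact image_congr fun y _ => y.2 h

lemma preimage_proj_preimage {i j : ι} (h : i ≤ j) (V : Set (X i)) :
    proj f j ⁻¹' (f h ⁻¹' V) = proj f i ⁻¹' V := by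
  ext y
  exact iff_of_eq (congrArg (· ∈ V) (y.2 h))

variable [∀ i, TopologicalSpace (X i)]

lemma continuous_proj (i : ι) : Continuous (proj f i) :=
  (continuous_apply i).comp continuous_subtype_val

lemma isSpectralMap_proj (hspec : ∀ ⦃i j : ι⦄ (h : i ≤ j), IsSpectralMap (f h))
    (hX : ∀ i, IsSpectralTop (X i)) (i : ι) : IsSpectralMap (proj f i) := by
  refine ⟨continuous_proj i, fun U ho hU => ?_⟩
  have := fun i => (hX i).compactSpace_constructible
  let g : (∀ i, WithConstructibleTopology (X i)) → ∀ i, X i :=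
    fun y i => WithTopology.ofTopology (y i)
  have hg : Continuous g := continuous_pi fun i =>
    (hX i).continuous_ofTopology.comp (continuous_apply i)
  have hclopen (k : ι) {V : Set (X k)} (hVo : IsOpen V) (hV : IsCompact V) :
      IsClopen {y | g y k ∈ V} :=
    (hV.isClopen_constructible_preimage hVo).preimage (continuous_apply k)
  have hlim : g ⁻¹' InvLim f = ⋂ (j) (k) (h : j ≤ k) (V : Set (X j)) (_ : IsOpen V)
      (_ : IsCompact V), {y | g y k ∈ f h ⁻¹' V ↔ g y j ∈ V} := by
    ext y
    simp only [mem_iInter]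
    exact ⟨fun hy j k h V _ _ => iff_of_eq (congrArg (· ∈ V) (hy h)),
      fun hy j k h => (hX j).eq_of_forall_mem_iff (hy j k h)⟩
  have hclosed : IsClosed (g ⁻¹' InvLim f) := by
    rw [hlim]
    refine isClosed_iInter fun j => isClosed_iInter fun k => isClosed_iInter fun h =>
      isClosed_iInter fun V => isClosed_iInter fun hVo => isClosed_iInter fun hV => ?_
    have hj := hclopen j hVo hV
    have hk := hclopen k (hVo.preimage (hspec h).continuous)
      (hV.preimage_of_isOpen (hspec h) hVo)
    simp_rw [iff_iff_implies_and_implies]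
    exact (isClosed_imp hk.isOpen hj.isClosed).inter (isClosed_imp hj.isOpen hk.isClosed)
  rw [Subtype.isCompact_iff]
  convert ((hclosed.inter (hclopen i ho hU).isClosed).isCompact).image hg using 1
  ext y
  constructor
  · rintro ⟨y, hy, rfl⟩
    exact ⟨fun i => WithTopology.toTopology _ (y.1 i), ⟨y.2, hy⟩, rfl⟩
  · rintro ⟨y, ⟨hy, hyU⟩, rfl⟩
    exact ⟨⟨g y, hy⟩, hyU, rfl⟩

lemma exists_proj_preimage_mem_subset [Nonempty ι] [IsDirected ι (· ≤ ·)]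
    (hf : ∀ ⦃i j : ι⦄ (h : i ≤ j), Continuous (f h)) (hX : ∀ i, IsSpectralTop (X i))
    {W : Set ↥(InvLim f)} (hW : IsOpen W) {y : ↥(InvLim f)} (hy : y ∈ W) :
    ∃ (i : ι) (V : Set (X i)), (IsOpen V ∧ IsCompact V) ∧ y ∈ proj f i ⁻¹' V ∧
      proj f i ⁻¹' V ⊆ W := by
  obtain ⟨W', hW', rfl⟩ := isOpen_induced_iff.1 hW
  obtain ⟨F, U, hU, hFU⟩ := isOpen_pi_iff.1 hW' y.1 hy
  obtain ⟨j, hj⟩ := F.exists_le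
  obtain ⟨V, hV, hyV, hVU⟩ := (hX j).isTopologicalBasis.exists_subset_of_mem_open
    (a := proj f j y) (u := ⋂ i : F, f (hj i i.2) ⁻¹' U i)
    (mem_iInter.2 fun i => by
      change f _ (y.1 j) ∈ U i
      rw [y.2 (hj i i.2)]
      exact (hU i i.2).2)
    (isOpen_iInter_of_finite fun i => (hU i i.2).1.preimage (hf _))
  refine ⟨j, V, hV, hyV, fun z hz => hFU fun i hi => ?_⟩
  rw [← z.2 (hj i hi)]
  exact mem_iInter.1 (hVU hz) ⟨i, hi⟩

lemma exists_eq_proj_preimage [Nonempty ι] [IsDirected ι (· ≤ ·)]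
    (hspec : ∀ ⦃i j : ι⦄ (h : i ≤ j), IsSpectralMap (f h)) (hX : ∀ i, IsSpectralTop (X i))
    {W : Set ↥(InvLim f)} (ho : IsOpen W) (hW : IsCompact W) :
    ∃ (i : ι) (V : Set (X i)), (IsOpen V ∧ IsCompact V) ∧ W = proj f i ⁻¹' V := by
  suffices ∃ (i : ι) (V : Set (X i)), (IsOpen V ∧ IsCompact V) ∧ W ⊆ proj f i ⁻¹' V ∧
      proj f i ⁻¹' V ⊆ W by
    obtain ⟨i, V, hV, h₁, h₂⟩ := this
    exact ⟨i, V, hV, h₁.antisymm h₂⟩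
  refine hW.induction_on (p := fun s => ∃ (i : ι) (V : Set (X i)), (IsOpen V ∧ IsCompact V) ∧
    s ⊆ proj f i ⁻¹' V ∧ proj f i ⁻¹' V ⊆ W) ?_ ?_ ?_ ?_
  · exact ⟨Classical.arbitrary ι, ∅, ⟨isOpen_empty, isCompact_empty⟩, by simp⟩
  · rintro s t hst ⟨i, V, hV, htV, hVW⟩
    exact ⟨i, V, hV, hst.trans htV, hVW⟩
  · rintro s t ⟨i, V, ⟨hVo, hV⟩, hsV, hVW⟩ ⟨j, V', ⟨hVo', hV'⟩, htV, hVW'⟩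
    obtain ⟨k, hik, hjk⟩ := exists_ge_ge i j
    refine ⟨k, f hik ⁻¹' V ∪ f hjk ⁻¹' V',
      ⟨(hVo.preimage (hspec hik).continuous).union (hVo'.preimage (hspec hjk).continuous),
        (hV.preimage_of_isOpen (hspec hik) hVo).union (hV'.preimage_of_isOpen (hspec hjk) hVo')⟩,
      ?_⟩
    rw [preimage_union, preimage_proj_preimage, preimage_proj_preimage]
    exact ⟨union_subset_union hsV htV, union_subset hVW hVW'⟩
  · intro y hy
    obtain ⟨i, V, hV, hyV, hVW⟩ :=
      exists_proj_preimage_mem_subset (fun i j h => (hspec h).continuous) hX ho hy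
    exact ⟨_, mem_nhdsWithin_of_mem_nhds ((hV.1.preimage (continuous_proj i)).mem_nhds hyV),
      i, V, hV, Subset.rfl, hVW⟩

end InvLim

lemma IsSpectralMap.image_invC_subset {Y : Type*} [TopologicalSpace Y] {g : X → Y}
    (hg : IsSpectralMap g) (A : Set X) : g '' invC A ⊆ invC (g '' A) := by
  rintro _ ⟨x, hx, rfl⟩ U ⟨⟨ho, hU⟩, hAU⟩
  exact hx (g ⁻¹' U) ⟨⟨ho.preimage hg.continuous, hU.preimage_of_isOpen hg ho⟩,
    image_subset_iff.1 hAU⟩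

lemma IsSpectralMap.image_patchC_subset {Y : Type*} [TopologicalSpace Y] {g : X → Y}
    (hg : IsSpectralMap g) (A : Set X) : g '' patchC A ⊆ patchC (g '' A) := by
  rintro _ ⟨x, hx, rfl⟩ _ ⟨⟨U, V, ⟨ho, hU⟩, ⟨ho', hV⟩, rfl⟩, hAU⟩
  exact hx (g ⁻¹' (U ∪ Vᶜ)) ⟨⟨g ⁻¹' U, g ⁻¹' V,
    ⟨ho.preimage hg.continuous, hU.preimage_of_isOpen hg ho⟩,
    ⟨ho'.preimage hg.continuous, hV.preimage_of_isOpen hg ho'⟩, rfl⟩, image_subset_iff.1 hAU⟩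

/-- Let `Y = InvLim f` be the projective limit of a cofiltered projective system of spectral
spaces with spectral transition maps, and `Z ⊆ Y`.  Then the families `patch(dᵢ(Z))` and
`inv(dᵢ(Z))` form projective systems under the transition maps, and the projections identify
`patch(Z)` with `lim patch(dᵢ(Z))` and `inv(Z)` with `lim inv(dᵢ(Z))`: as subspaces of the
limit (which carries the subspace topology of the product) these limits are exactly
`{y : ∀ i, dᵢ(y) ∈ patch(dᵢ(Z))}` and `{y : ∀ i, dᵢ(y) ∈ inv(dᵢ(Z))}`, so the set equalities
below are homeomorphisms of subspaces. -/
theorem stmt13 {ι : Type*} [Preorder ι] [Nonempty ι] [IsDirected ι (· ≤ ·)]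
    {X : ι → Type*} [∀ i, TopologicalSpace (X i)]
    (f : ∀ ⦃i j : ι⦄, i ≤ j → X j → X i)
    (hid : ∀ i, f (le_refl i) = id)
    (hcomp : ∀ ⦃i j k : ι⦄ (hij : i ≤ j) (hjk : j ≤ k), f hij ∘ f hjk = f (hij.trans hjk))
    (hspec : ∀ ⦃i j : ι⦄ (h : i ≤ j), IsSpectralMap (f h))
    (hX : ∀ i, IsSpectralTop (X i))
    (Z : Set ↥(InvLim f)) :
    (∀ ⦃i j : ι⦄ (h : i ≤ j), f h '' patchC (proj f j '' Z) ⊆ patchC (proj f i '' Z)) ∧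
    (∀ ⦃i j : ι⦄ (h : i ≤ j), f h '' invC (proj f j '' Z) ⊆ invC (proj f i '' Z)) ∧
    patchC Z = {y : ↥(InvLim f) | ∀ i, proj f i y ∈ patchC (proj f i '' Z)} ∧
    invC Z = {y : ↥(InvLim f) | ∀ i, proj f i y ∈ invC (proj f i '' Z)} := by
  have hproj := isSpectralMap_proj hspec hX
  refine ⟨fun i j h => ?_, fun i j h => ?_, Subset.antisymm (fun y hy i => ?_) ?_,
    Subset.antisymm (fun y hy i => ?_) ?_⟩
  · rw [← image_proj_image h]
    exact (hspec h).image_patchC_subset _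
  · rw [← image_proj_image h]
    exact (hspec h).image_invC_subset _
  · exact (hproj i).image_patchC_subset Z (mem_image_of_mem _ hy)
  · rintro y hy _ ⟨⟨U, V, ⟨ho, hU⟩, ⟨ho', hV⟩, rfl⟩, hZ⟩
    obtain ⟨i, U, ⟨hUo, hUc⟩, rfl⟩ := exists_eq_proj_preimage hspec hX ho hU
    obtain ⟨j, V, ⟨hVo, hVc⟩, rfl⟩ := exists_eq_proj_preimage hspec hX ho' hV
    obtain ⟨k, hik, hjk⟩ := exists_ge_ge i j
    rw [← preimage_proj_preimage hik, ← preimage_proj_preimage hjk] at hZ ⊢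
    exact hy k (f hik ⁻¹' U ∪ (f hjk ⁻¹' V)ᶜ) ⟨⟨_, _,
      ⟨hUo.preimage (hspec hik).continuous, hUc.preimage_of_isOpen (hspec hik) hUo⟩,
      ⟨hVo.preimage (hspec hjk).continuous, hVc.preimage_of_isOpen (hspec hjk) hVo⟩, rfl⟩,
      image_subset_iff.2 hZ⟩
  · exact (hproj i).image_invC_subset Z (mem_image_of_mem _ hy)
  · rintro y hy U ⟨⟨ho, hU⟩, hZ⟩
    obtain ⟨i, V, hV, rfl⟩ := exists_eq_proj_preimage hspec hX ho hU
    exact hy i V ⟨hV, image_subset_iff.2 hZ⟩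
end
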